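/- Let n ≥ 1 and 1 < p < 2. Let u ∈ C²(ℝⁿ₊) ∩ C(cl ℝⁿ₊) be a classical solution of -Δu = |∇u|^p in ℝⁿ₊ with u = 0 on ∂ℝⁿ₊. Then sup_{x ∈ ℝⁿ₊} |u(x)| < ∞. -/

import Mathlib

/-- The classical Laplacian of `u : ℝⁿ → ℝ`: the sum of the pure second
derivatives `∂²u/∂xᵢ²`. -/
noncomputable def laplacian {n : ℕ} (u : EuclideanSpace ℝ (Fin n) → ℝ)
    (x : EuclideanSpace ℝ (Fin n)) : ℝ :=
  ∑ i, iteratedFDeriv ℝ 2 u x ![EuclideanSpace.single i 1, EuclideanSpace.single i 1]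

/-- The open half-space `ℝⁿ₊ = {x ∈ ℝⁿ : xₙ > 0}` (dimension `n + 1`, so `n + 1 ≥ 1`). -/
def halfSpace (n : ℕ) : Set (EuclideanSpace ℝ (Fin (n + 1))) :=
  {x | 0 < x (Fin.last n)}

open Topology Filter Set

/-- `f` has first derivative `a` and second derivative `b` at `0`. -/
def LineD2 (f : ℝ → ℝ) (a b : ℝ) : Prop :=
  ∃ f' : ℝ → ℝ, (∀ᶠ t in 𝓝 (0:ℝ), HasDerivAt f (f' t) t) ∧ f' 0 = a ∧ HasDerivAt f' b 0

lemma LineD2.add {f g : ℝ → ℝ} {a b c d : ℝ} (hf : LineD2 f a b) (hg : LineD2 g c d) :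
    LineD2 (fun t => f t + g t) (a + c) (b + d) := by
  obtain ⟨f', h1, h2, h3⟩ := hf
  obtain ⟨g', k1, k2, k3⟩ := hg
  refine ⟨fun t => f' t + g' t, ?_, by simp [h2, k2], h3.add k3⟩
  filter_upwards [h1, k1] with t ht kt using ht.add kt

lemma LineD2.sub {f g : ℝ → ℝ} {a b c d : ℝ} (hf : LineD2 f a b) (hg : LineD2 g c d) :
    LineD2 (fun t => f t - g t) (a - c) (b - d) := by
  obtain ⟨f', h1, h2, h3⟩ := hf
  obtain ⟨g', k1, k2, k3⟩ := hg
  refine ⟨fun t => f' t - g' t, ?_, by simp [h2, k2], h3.sub k3⟩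
  filter_upwards [h1, k1] with t ht kt using ht.sub kt

lemma LineD2.const_mul {f : ℝ → ℝ} {a b : ℝ} (c : ℝ) (hf : LineD2 f a b) :
    LineD2 (fun t => c * f t) (c * a) (c * b) := by
  obtain ⟨f', h1, h2, h3⟩ := hf
  refine ⟨fun t => c * f' t, ?_, by simp [h2], h3.const_mul c⟩
  filter_upwards [h1] with t ht using ht.const_mul c

lemma LineD2.comp_mul {f : ℝ → ℝ} {a b : ℝ} (c : ℝ) (hf : LineD2 f a b) :
    LineD2 (fun t => f (c * t)) (c * a) (c ^ 2 * b) := by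
  obtain ⟨f', h1, h2, h3⟩ := hf
  refine ⟨fun t => c * f' (c * t), ?_, by simp [h2], ?_⟩
  · have : Tendsto (fun t : ℝ => c * t) (𝓝 0) (𝓝 0) := by
      have : Continuous (fun t : ℝ => c * t) := by fun_prop
      simpa using this.tendsto 0
    filter_upwards [this.eventually h1] with t ht
    have h4 : HasDerivAt (fun t : ℝ => c * t) c t := by
      simpa using (hasDerivAt_id t).const_mul c
    have := HasDerivAt.comp t ht h4
    rw [mul_comm]
    exact this
  · have h4 : HasDerivAt (fun t : ℝ => c * t) c 0 := by
      simpa using (hasDerivAt_id (0:ℝ)).const_mul c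
    have h5 : HasDerivAt f' b (c * 0) := by simpa using h3
    have := (HasDerivAt.comp 0 h5 h4).const_mul c
    exact this.congr_deriv (by ring)

lemma LineD2.congr {f : ℝ → ℝ} {a b a' b' : ℝ} (hf : LineD2 f a b) (ha : a = a') (hb : b = b') :
    LineD2 f a' b' := by subst ha; subst hb; exact hf

/-- quadratic polynomials -/
lemma LineD2.quad (k l m : ℝ) : LineD2 (fun t => k + l * t + m * t ^ 2) l (2 * m) := by
  refine ⟨fun t => l + 2 * m * t, ?_, by simp, ?_⟩
  · refine Eventually.of_forall fun t => ?_
    have := (((hasDerivAt_id t).const_mul l).const_add k).add (((hasDerivAt_id t).pow 2).const_mul m)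
    exact this.congr_deriv (by simp; ring)
  · have := ((hasDerivAt_id (0:ℝ)).const_mul (2*m)).const_add l
    exact this.congr_deriv (by simp)

lemma LineD2.max {f : ℝ → ℝ} {a b : ℝ} (hf : LineD2 f a b) (hm : IsLocalMax f 0) :
    a = 0 ∧ b ≤ 0 := by
  obtain ⟨f', h1, h2, h3⟩ := hf
  have h10 := h1.self_of_nhds
  have ha : f' 0 = 0 := hm.hasDerivAt_eq_zero h10
  refine ⟨by rw [← h2, ha], ?_⟩
  by_contra! hb
  have hd : deriv f =ᶠ[𝓝 0] f' := by
    filter_upwards [h1] with t ht using ht.deriv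
  have hdd : deriv (deriv f) 0 = b := by
    rw [hd.deriv_eq]; exact h3.deriv
  have hmin := isLocalMin_of_deriv_deriv_pos (f := f) (x₀ := 0) (by rw [hdd]; exact hb)
    (by rw [h10.deriv, ha]) h10.continuousAt
  have hc : f =ᶠ[𝓝 0] fun _ => f 0 := by
    filter_upwards [hm, hmin] with t ht kt using le_antisymm ht kt
  have : f' =ᶠ[𝓝 0] fun _ => 0 := by
    filter_upwards [h1, hc.eventuallyEq_nhds] with t ht kt
    have := kt.deriv_eq
    rw [ht.deriv] at this
    simpa using this
  have h6 := this.deriv_eq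
  rw [h3.deriv] at h6
  simp at h6
  linarith

/-- restriction of a `C²` function to a line -/
lemma lineD2_of_contDiffAt {n : ℕ} {u : EuclideanSpace ℝ (Fin n) → ℝ}
    {x : EuclideanSpace ℝ (Fin n)} (hu : ContDiffAt ℝ 2 u x) (e : EuclideanSpace ℝ (Fin n)) :
    LineD2 (fun t => u (x + t • e)) (inner ℝ (gradient u x) e)
      (iteratedFDeriv ℝ 2 u x ![e, e]) := by
  have hline : ∀ t : ℝ, HasDerivAt (fun t : ℝ => x + t • e) e t := fun t => by
    simpa using ((hasDerivAt_id t).smul_const e).const_add x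
  refine ⟨fun t => fderiv ℝ u (x + t • e) e, ?_, by simp [inner_gradient_left], ?_⟩
  · have h1 : ∀ᶠ y in 𝓝 x, DifferentiableAt ℝ u y := by
      filter_upwards [hu.eventually (by simp)] with y hy using hy.differentiableAt (by norm_num)
    have h2 : Tendsto (fun t : ℝ => x + t • e) (𝓝 0) (𝓝 x) := by
      have : Continuous (fun t : ℝ => x + t • e) := by fun_prop
      simpa using this.tendsto 0
    filter_upwards [h2.eventually h1] with t ht
    exact ht.hasFDerivAt.comp_hasDerivAt t (hline t)
  · have h1 : DifferentiableAt ℝ (fderiv ℝ u) x :=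
      (hu.fderiv_right (m := 1) (by norm_num)).differentiableAt (by norm_num)
    have h2 : HasFDerivAt (fderiv ℝ u) (fderiv ℝ (fderiv ℝ u) x) (x + (0:ℝ) • e) := by
      simpa using h1.hasFDerivAt
    have h3 : HasDerivAt (fun t : ℝ => fderiv ℝ u (x + t • e)) (fderiv ℝ (fderiv ℝ u) x e) 0 :=
      h2.comp_hasDerivAt 0 (hline 0)
    have h4 : HasDerivAt (fun t : ℝ => fderiv ℝ u (x + t • e) e)
        (fderiv ℝ (fderiv ℝ u) x e e) 0 :=
      ((ContinuousLinearMap.apply ℝ ℝ e).hasFDerivAt).comp_hasDerivAt 0 h3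
    rw [iteratedFDeriv_two_apply]
    exact h4

lemma norm_gradient_eq {n : ℕ} (u : EuclideanSpace ℝ (Fin n) → ℝ) (x : EuclideanSpace ℝ (Fin n)) :
    ‖gradient u x‖ = ‖fderiv ℝ u x‖ := by
  rw [← toDual_gradient, LinearIsometryEquiv.norm_map]

lemma rpow_tangent {p P q δ : ℝ} (hp : 1 ≤ p) (hP : 0 ≤ P) (hq : 0 ≤ q) (hδ : 0 ≤ δ)
    (h : P - δ ≤ q) : P ^ p - p * P ^ (p - 1) * δ ≤ q ^ p := by
  rcases hP.eq_or_lt with rfl | hP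
  · rw [Real.zero_rpow (by linarith)]
    have : 0 ≤ q ^ p := Real.rpow_nonneg hq p
    have h2 : 0 ≤ p * 0 ^ (p - 1) * δ := by positivity
    linarith
  · have h1 := one_add_mul_self_le_rpow_one_add (s := q / P - 1)
      (by have : 0 ≤ q / P := by positivity
          linarith) hp
    have h2 : (1 + (q / P - 1)) ^ p = q ^ p / P ^ p := by
      rw [← Real.div_rpow hq hP.le]; congr 1; ring
    rw [h2, le_div_iff₀ (by positivity)] at h1
    have h3 : P ^ p = P ^ (p - 1) * P := by
      rw [← Real.rpow_add_one hP.ne']; congr 1; ring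
    have h4 : 0 < P ^ (p - 1) := by positivity
    refine le_trans ?_ h1
    rw [h3]
    have : (1 + p * (q / P - 1)) * (P ^ (p - 1) * P) = P ^ (p - 1) * P + p * P ^ (p - 1) * (q - P) := by
      field_simp
    rw [this]
    have : p * P ^ (p - 1) * (-δ) ≤ p * P ^ (p - 1) * (q - P) :=
      mul_le_mul_of_nonneg_left (by linarith) (by positivity)
    linarith

lemma gradBernstein_alg {d N Y g H X κ D1 D2 : ℝ} (hd : 0 < d) (hN : 0 < N) 
    (hκ : κ = Y / d) (hD1 : D1 = -Y) (hD2 : D2 ≤ -(Y - g / N))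
    (h : (1 + -κ / N) ^ 2 * D1 - D2 - d * N * (-κ / N) ^ 2 - H / N ≤ 0)
    (hX : g + H < Y ^ 2 / (2 * d)) (hYN : 2 * Y ≤ d * N) : X < X := by
  exfalso
  have h1 : 0 ≤ (Y ^ 2 / (2 * d)) * (1 - 2 * Y / (d * N)) := by
    have : 2 * Y / (d * N) ≤ 1 := by rw [div_le_one (by positivity)]; exact hYN
    have : 0 ≤ 1 - 2 * Y / (d * N) := by linarith
    positivity
  subst hD1 hκ
  have h2 : (1 + -(Y / d) / N) ^ 2 * (-Y) + (Y - g / N) - d * N * (-(Y / d) / N) ^ 2 - H / N ≤ 0 := by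
    linarith
  have h3 : (1 + -(Y / d) / N) ^ 2 * (-Y) + (Y - g / N) - d * N * (-(Y / d) / N) ^ 2 - H / N
      = (Y ^ 2 / (2 * d) + (Y ^ 2 / (2 * d)) * (1 - 2 * Y / (d * N)) - (g + H)) / N := by
    field_simp
    ring
  rw [h3] at h2
  have : 0 < (Y ^ 2 / (2 * d) + (Y ^ 2 / (2 * d)) * (1 - 2 * Y / (d * N)) - (g + H)) / N := by
    apply div_pos _ hN
    linarith
  linarith

lemma norm_line_sq {n : ℕ} (v : EuclideanSpace ℝ (Fin (n + 1))) (i : Fin (n + 1)) (t : ℝ) :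
    ‖v + t • EuclideanSpace.single i (1:ℝ)‖ ^ 2 = ‖v‖ ^ 2 + 2 * v i * t + 1 * t ^ 2 := by
  rw [norm_add_sq_real, inner_smul_right, EuclideanSpace.inner_single_right, norm_smul,
    PiLp.norm_single]
  simp
  ring

lemma gradBernstein {n : ℕ} {p : ℝ} (hp1 : 1 < p) {u : EuclideanSpace ℝ (Fin (n + 1)) → ℝ}
    {U : Set (EuclideanSpace ℝ (Fin (n + 1)))} (hU : IsOpen U) (hu : ContDiffOn ℝ 2 u U)
    (heq : ∀ x ∈ U, -laplacian u x = ‖gradient u x‖ ^ p)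
    (c : EuclideanSpace ℝ (Fin (n + 1))) {R R' : ℝ} (hR : 0 < R) (hRR : R < R')
    (hball : Metric.closedBall c R' ⊆ U)
    (φ : EuclideanSpace ℝ (Fin (n + 1)) → ℝ) (hφc : ContinuousOn φ (Metric.ball c R))
    (φ0 : ℝ) (hφ0 : 0 < φ0) (hφ : ∀ x ∈ Metric.ball c R, φ0 ≤ φ x)
    (hblow : ∀ M : ℝ, ∃ r, 0 ≤ r ∧ r < R ∧ ∀ x ∈ Metric.ball c R, r ≤ dist x c → M < φ x)
    (G : EuclideanSpace ℝ (Fin (n + 1)) → EuclideanSpace ℝ (Fin (n + 1)))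
    (h : EuclideanSpace ℝ (Fin (n + 1)) → Fin (n + 1) → ℝ)
    (hline : ∀ x ∈ Metric.ball c R, ∀ i,
      LineD2 (fun t => φ (x + t • EuclideanSpace.single i 1)) (G x i) (h x i))
    (hineq : ∀ x ∈ Metric.ball c R, ∀ P : ℝ, 0 ≤ P → φ x ≤ P ^ 2 →
      p * P ^ (p - 1) * ‖G x‖ + ∑ i, h x i < (P ^ p) ^ 2 / (2 * ((n : ℝ) + 1))) :
    ‖gradient u c‖ ^ 2 ≤ 2 * φ c := by
  by_contra! hcon
  have hcR : c ∈ Metric.ball c R := Metric.mem_ball_self hR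
  have hBc : IsCompact (Metric.closedBall c R') := isCompact_closedBall c R'
  have hfc : ContinuousOn (fderiv ℝ u) (Metric.closedBall c R') :=
    (hu.continuousOn_fderiv_of_isOpen hU (by norm_num)).mono hball
  have huc : ContinuousOn u (Metric.closedBall c R') := hu.continuousOn.mono hball
  have hdiff : ∀ x ∈ Metric.closedBall c R', DifferentiableAt ℝ u x := fun x hx =>
    (hu.contDiffAt (hU.mem_nhds (hball hx))).differentiableAt (by norm_num)
  have hcR' : c ∈ Metric.closedBall c R' := Metric.mem_closedBall_self (by linarith)
  obtain ⟨Λ, hΛ0, hΛ⟩ : ∃ Λ : ℝ, 0 < Λ ∧ ∀ x ∈ Metric.closedBall c R', ‖fderiv ℝ u x‖ ≤ Λ := by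
    obtain ⟨C, hC⟩ := hBc.exists_bound_of_continuousOn hfc
    exact ⟨max C 1, by positivity, fun x hx => (hC x hx).trans (le_max_left _ _)⟩
  set γ : ℝ := ‖gradient u c‖ ^ 2 / 2 - φ c with hγ
  have hγ0 : 0 < γ := by rw [hγ]; linarith
  obtain ⟨ε, hε0, hε1, hε2⟩ : ∃ ε : ℝ, 0 < ε ∧ ε ^ 2 ≤ φ0 / 4 ∧ ε * Λ ≤ γ / 2 := by
    refine ⟨min (√φ0 / 2) (γ / (2 * Λ)), by positivity, ?_, ?_⟩
    · calc (min (√φ0 / 2) (γ / (2 * Λ))) ^ 2 ≤ (√φ0 / 2) ^ 2 := by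
            gcongr; exact min_le_left _ _
        _ = φ0 / 4 := by rw [div_pow, Real.sq_sqrt hφ0.le]; norm_num
    · calc (min (√φ0 / 2) (γ / (2 * Λ))) * Λ ≤ (γ / (2 * Λ)) * Λ := by
            gcongr; exact min_le_right _ _
        _ = γ / 2 := by field_simp
  obtain ⟨δ0, hδ0, hmod⟩ : ∃ δ0 > 0, ∀ x ∈ Metric.closedBall c R', ∀ y ∈ Metric.closedBall c R',
      dist x y < δ0 → ‖fderiv ℝ u x - fderiv ℝ u y‖ ≤ ε := by
    have := hBc.uniformContinuousOn_of_continuous hfc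
    rw [Metric.uniformContinuousOn_iff] at this
    obtain ⟨δ, hδ, H⟩ := this ε hε0
    exact ⟨δ, hδ, fun x hx y hy hxy => by rw [← dist_eq_norm]; exact (H x hx y hy hxy).le⟩
  have htay : ∀ w ∈ Metric.closedBall c R', ∀ x ∈ Metric.closedBall c R',
      ∀ y ∈ Metric.closedBall c R', dist x w < δ0 → dist y w < δ0 →
      |u y - u x - inner ℝ (gradient u w) (y - x)| ≤ ε * ‖y - x‖ := by
    intro w hw x hx y hy hxw hyw
    have := Convex.norm_image_sub_le_of_norm_fderiv_le' (𝕜 := ℝ) (f := u) (C := ε)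
      (s := Metric.closedBall c R' ∩ Metric.ball w δ0) (φ := fderiv ℝ u w)
      (fun z hz => hdiff z hz.1) (fun z hz => hmod z hz.1 w hw hz.2)
      ((convex_closedBall c R').inter (convex_ball w δ0)) ⟨hx, hxw⟩ ⟨hy, hyw⟩
    rw [inner_gradient_left]
    exact this
  obtain ⟨r, hr0, hrR, hr⟩ := hblow (2 * Λ ^ 2)
  -- choice of `N`
  obtain ⟨N, hN0, hN1, hN2, hN3⟩ : ∃ N : ℝ, 0 < N ∧ 2 * Λ / N ≤ R' - R ∧ 2 * Λ / N < δ0 ∧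
      2 * (2 * Λ) ^ p ≤ ((n : ℝ) + 1) * N := by
    have hd : 0 < R' - R := by linarith
    refine ⟨2 * Λ / (R' - R) + 4 * Λ / δ0 + 2 * (2 * Λ) ^ p, by positivity, ?_, ?_, ?_⟩
    · rw [div_le_iff₀ (by positivity)]
      have : (R' - R) * (2 * Λ / (R' - R)) = 2 * Λ := by field_simp
      have h2 : 0 ≤ (R' - R) * (4 * Λ / δ0 + 2 * (2 * Λ) ^ p) := by positivity
      linarith
    · rw [div_lt_iff₀ (by positivity)]
      have : δ0 * (4 * Λ / δ0) = 4 * Λ := by field_simp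
      have h2 : 0 ≤ δ0 * (2 * Λ / (R' - R) + 2 * (2 * Λ) ^ p) := by positivity
      linarith
    · have : 0 ≤ 2 * Λ / (R' - R) + 4 * Λ / δ0 := by positivity
      have h3 : 0 ≤ (n:ℝ) * (2 * Λ / (R' - R) + 4 * Λ / δ0 + 2 * (2 * Λ) ^ p) := by positivity
      linarith
  set δ := 2 * Λ / N with hδ
  have hδpos : 0 < δ := by positivity
  let F : EuclideanSpace ℝ (Fin (n + 1)) × EuclideanSpace ℝ (Fin (n + 1)) → ℝ :=
    fun z => u (z.1 + z.2) - u z.1 - N / 2 * ‖z.2‖ ^ 2 - 1 / N * φ z.1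
  have hadd : ∀ x ∈ Metric.closedBall c R, ∀ v ∈ Metric.closedBall (0 : EuclideanSpace ℝ (Fin (n + 1))) δ,
      x + v ∈ Metric.closedBall c R' := by
    intro x hx v hv
    rw [mem_closedBall_iff_norm] at *
    have : x + v - c = (x - c) + (v - 0) := by abel
    rw [this]
    exact (norm_add_le _ _).trans (by linarith)
  have hRsub : Metric.closedBall c R ⊆ Metric.closedBall c R' := Metric.closedBall_subset_closedBall hRR.le
  have hrsub : Metric.closedBall c r ⊆ Metric.ball c R := Metric.closedBall_subset_ball hrR
  have hrsub' : Metric.closedBall c r ⊆ Metric.closedBall c R := Metric.closedBall_subset_closedBall hrR.le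
  set K : Set (EuclideanSpace ℝ (Fin (n + 1)) × EuclideanSpace ℝ (Fin (n + 1))) :=
    Metric.closedBall c r ×ˢ Metric.closedBall 0 δ with hK
  have hKc : IsCompact K := (isCompact_closedBall _ _).prod (isCompact_closedBall _ _)
  have hFc : ContinuousOn F K := by
    refine ContinuousOn.sub (ContinuousOn.sub (ContinuousOn.sub ?_ ?_) ?_) ?_
    · refine huc.comp (by fun_prop) ?_
      rintro ⟨x, v⟩ ⟨hx, hv⟩
      exact hadd x (hrsub' hx) v hv
    · refine huc.comp (by fun_prop) ?_
      rintro ⟨x, v⟩ ⟨hx, hv⟩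
      exact hRsub (hrsub' hx)
    · fun_prop
    · refine continuousOn_const.mul (hφc.comp (by fun_prop) ?_)
      rintro ⟨x, v⟩ ⟨hx, hv⟩
      exact hrsub hx
  have hgradc : ‖gradient u c‖ ≤ Λ := by rw [norm_gradient_eq]; exact hΛ c hcR'
  have hv0 : (1 / N) • gradient u c ∈ Metric.closedBall (0 : EuclideanSpace ℝ (Fin (n + 1))) δ := by
    rw [mem_closedBall_zero_iff, norm_smul, hδ, Real.norm_of_nonneg (by positivity)]
    rw [one_div, inv_mul_eq_div]
    gcongr
    linarith
  have hK0 : (c, (1 / N) • gradient u c) ∈ K := ⟨Metric.mem_closedBall_self hr0, hv0⟩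
  obtain ⟨⟨x, v⟩, hxvK, hmax⟩ := hKc.exists_isMaxOn ⟨_, hK0⟩ hFc
  have hF0 : 0 < F (c, (1 / N) • gradient u c) := by
    have h1 := htay c hcR' c hcR' (c + (1 / N) • gradient u c)
      (hadd c (hrsub' (Metric.mem_closedBall_self hr0)) _ hv0) (by simpa using hδ0)
      (by rw [dist_eq_norm, add_sub_cancel_left]
          rw [mem_closedBall_zero_iff] at hv0
          linarith)
    rw [add_sub_cancel_left, inner_smul_right, real_inner_self_eq_norm_sq, norm_smul,
      Real.norm_of_nonneg (by positivity)] at h1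
    have h2 := (abs_le.1 h1).1
    have h3 : ε * ‖gradient u c‖ ≤ γ / 2 := (mul_le_mul_of_nonneg_left hgradc hε0.le).trans hε2
    have h4 : F (c, (1 / N) • gradient u c) = u (c + (1 / N) • gradient u c) - u c
        - 1 / N * (‖gradient u c‖ ^ 2 / 2 + φ c) := by
      simp only [F]
      rw [norm_smul, Real.norm_of_nonneg (by positivity)]
      field_simp
      ring
    have h5 : 0 < 1 / N * (γ - ε * ‖gradient u c‖) := by
      apply mul_pos (by positivity); linarith
    have h6 : 1 / N * (γ - ε * ‖gradient u c‖) = 1 / N * ‖gradient u c‖ ^ 2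
        - 1 / N * (‖gradient u c‖ ^ 2 / 2 + φ c) - ε * (1 / N * ‖gradient u c‖) := by
      rw [hγ]; ring
    rw [h4]
    linarith
  have hFpos : 0 < F (x, v) := hF0.trans_le (hmax hK0)
  obtain ⟨hx, hv⟩ := hxvK
  simp only at hx hv
  have hxb : x ∈ Metric.ball c R := hrsub hx
  have hxB : x ∈ Metric.closedBall c R' := hRsub (hrsub' hx)
  have hyB : x + v ∈ Metric.closedBall c R' := hadd x (hrsub' hx) v hv
  have hFpos' : 0 < u (x + v) - u x - N / 2 * ‖v‖ ^ 2 - 1 / N * φ x := hFpos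
  have hlip : u (x + v) - u x ≤ Λ * ‖v‖ := by
    have := Convex.norm_image_sub_le_of_norm_fderiv_le (𝕜 := ℝ) (f := u) (C := Λ) hdiff hΛ
      (convex_closedBall c R') hxB hyB
    rw [add_sub_cancel_left] at this
    exact (le_abs_self _).trans this
  have hvδ : ‖v‖ ≤ δ := by simpa using hv
  have hφx : 0 < φ x := hφ0.trans_le (hφ x hxb)
  have hNφ : 0 < 1 / N * φ x := by positivity
  -- interior
  have hxr : x ∈ Metric.ball c r := by
    rw [Metric.mem_ball]
    by_contra! hc
    have h1 := hr x hxb hc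
    have h2 : 1 / N * φ x < Λ * δ := by
      have : Λ * ‖v‖ ≤ Λ * δ := by gcongr
      have : 0 ≤ N / 2 * ‖v‖ ^ 2 := by positivity
      linarith
    rw [hδ] at h2
    have h3 : Λ * (2 * Λ / N) = 1 / N * (2 * Λ ^ 2) := by ring
    rw [h3] at h2
    have := lt_of_mul_lt_mul_left h2 (by positivity)
    linarith
  have hvpos : 0 < ‖v‖ := by
    by_contra! hc
    have h0 : ‖v‖ = 0 := le_antisymm hc (norm_nonneg _)
    rw [h0] at hlip hFpos'
    linarith
  have hvlt : ‖v‖ < δ := by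
    have h1 : N / 2 * ‖v‖ ^ 2 < Λ * ‖v‖ := by linarith
    have h2 : N / 2 * ‖v‖ < Λ := by
      have : (N / 2 * ‖v‖) * ‖v‖ < Λ * ‖v‖ := by linarith
      exact lt_of_mul_lt_mul_right this hvpos.le
    rw [hδ, lt_div_iff₀ hN0]
    linarith
  have hloc : ∀ (i : Fin (n + 1)) (α β : ℝ), IsLocalMax (fun t : ℝ =>
      F (x + (α * t) • EuclideanSpace.single i 1, v + (β * t) • EuclideanSpace.single i 1)) 0 := by
    intro i α β
    have hc : Continuous (fun t : ℝ => (x + (α * t) • EuclideanSpace.single i (1:ℝ),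
      v + (β * t) • EuclideanSpace.single i (1:ℝ))) := by fun_prop
    have hn : K ∈ 𝓝 (x, v) := prod_mem_nhds
      (mem_of_superset (Metric.isOpen_ball.mem_nhds hxr) Metric.ball_subset_closedBall)
      (mem_of_superset (Metric.isOpen_ball.mem_nhds (by simpa using hvlt))
        Metric.ball_subset_closedBall)
    have ht := hc.tendsto 0
    simp only [mul_zero, zero_smul, add_zero] at ht
    filter_upwards [ht.eventually hn] with t ht
    simpa using hmax ht
  have hCx : ContDiffAt ℝ 2 u x := hu.contDiffAt (hU.mem_nhds (hball hxB))
  have hCy : ContDiffAt ℝ 2 u (x + v) := hu.contDiffAt (hU.mem_nhds (hball hyB))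
  have key : ∀ (i : Fin (n + 1)) (α β : ℝ),
      ((α + β) * gradient u (x + v) i - α * gradient u x i - N / 2 * (β * (2 * v i))
        - 1 / N * (α * G x i) = 0) ∧
      ((α + β) ^ 2 * iteratedFDeriv ℝ 2 u (x + v) ![EuclideanSpace.single i 1, EuclideanSpace.single i 1]
        - α ^ 2 * iteratedFDeriv ℝ 2 u x ![EuclideanSpace.single i 1, EuclideanSpace.single i 1]
        - N / 2 * (β ^ 2 * (2 * 1)) - 1 / N * (α ^ 2 * h x i) ≤ 0) := by
    intro i α β
    have l1 := (lineD2_of_contDiffAt hCy (EuclideanSpace.single i 1)).comp_mul (α + β)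
    have l2 := (lineD2_of_contDiffAt hCx (EuclideanSpace.single i 1)).comp_mul α
    have l3 := ((LineD2.quad (‖v‖ ^ 2) (2 * v i) 1).comp_mul β).const_mul (N / 2)
    have l4 := ((hline x hxb i).comp_mul α).const_mul (1 / N)
    have l5 := ((l1.sub l2).sub l3).sub l4
    have l6 := l5.max (by
      convert hloc i α β using 2 with t
      simp only [F]
      rw [norm_line_sq]
      have e1 : x + v + ((α + β) * t) • EuclideanSpace.single i (1:ℝ)
          = x + (α * t) • EuclideanSpace.single i (1:ℝ)
            + (v + (β * t) • EuclideanSpace.single i (1:ℝ)) := by module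
      rw [e1])
    rw [EuclideanSpace.inner_single_right, EuclideanSpace.inner_single_right, one_mul, one_mul] at l6
    exact l6
  have hPv : gradient u (x + v) = N • v := by
    ext i
    have := (key i 0 1).1
    simp only [PiLp.smul_apply, smul_eq_mul]
    linarith
  have hQ : gradient u x = gradient u (x + v) - (1 / N) • G x := by
    ext i
    have := (key i 1 0).1
    simp only [PiLp.smul_apply, smul_eq_mul, PiLp.sub_apply]
    linarith
  set P : ℝ := ‖gradient u (x + v)‖ with hP
  have hPN : P = N * ‖v‖ := by rw [hP, hPv, norm_smul, Real.norm_of_nonneg hN0.le]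
  have hP0 : 0 ≤ P := norm_nonneg _
  have hPΛ : P ≤ 2 * Λ := by
    rw [hPN]
    have : N * ‖v‖ ≤ N * δ := by gcongr
    have h2 : N * δ = 2 * Λ := by rw [hδ]; field_simp
    linarith
  have hφP : φ x ≤ P ^ 2 := by
    have h1 := htay (x + v) hyB x hxB (x + v) hyB
      (by rw [dist_eq_norm, sub_add_cancel_left, norm_neg]; linarith) (by simpa using hδ0)
    rw [add_sub_cancel_left, hPv, inner_smul_left, real_inner_self_eq_norm_sq] at h1
    simp only [conj_trivial] at h1
    have h2 := (abs_le.1 h1).2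
    have h3 : 1 / N * φ x < N / 2 * ‖v‖ ^ 2 + ε * ‖v‖ := by linarith
    have h4 : φ x < P ^ 2 / 2 + ε * P := by
      have : N * (1 / N * φ x) < N * (N / 2 * ‖v‖ ^ 2 + ε * ‖v‖) := mul_lt_mul_of_pos_left h3 hN0
      have h5 : N * (1 / N * φ x) = φ x := by field_simp
      rw [hPN]
      rw [h5] at this
      calc _ < _ := this
        _ = _ := by ring
    have h6 := hφ x hxb
    have h7 := sq_nonneg (P / 2 - ε)
    nlinarith
  have hsum : (1 + -(P ^ p / ((n : ℝ) + 1)) / N) ^ 2 * laplacian u (x + v) - laplacian u x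
      - ((n : ℝ) + 1) * N * (-(P ^ p / ((n : ℝ) + 1)) / N) ^ 2 - (∑ i, h x i) / N ≤ 0 := by
    have := Finset.sum_nonpos (s := Finset.univ) fun i _ =>
      (key i 1 (-(P ^ p / ((n : ℝ) + 1)) / N)).2
    simp only [Finset.sum_sub_distrib, ← Finset.mul_sum] at this
    simp only [Finset.sum_const, Finset.card_univ, Fintype.card_fin, nsmul_eq_mul] at this
    push_cast at this
    unfold laplacian
    refine le_trans (le_of_eq ?_) this
    ring
  have hlapy : laplacian u (x + v) = -(P ^ p) := by
    have := heq (x + v) (hball hyB)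
    linarith
  have hlapx : laplacian u x ≤ -(P ^ p - (p * P ^ (p - 1) * ‖G x‖) / N) := by
    have h1 := heq x (hball hxB)
    have h2 := rpow_tangent (p := p) (P := P) (q := ‖gradient u x‖) (δ := 1 / N * ‖G x‖) hp1.le hP0
      (norm_nonneg _) (by positivity) (by
        rw [hQ, hP]
        have := norm_sub_norm_le (gradient u (x + v)) ((1 / N) • G x)
        rw [norm_smul, Real.norm_of_nonneg (by positivity : 0 ≤ 1 / N)] at this
        linarith)
    have h3 : p * P ^ (p - 1) * (1 / N * ‖G x‖) = (p * P ^ (p - 1) * ‖G x‖) / N := by ring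
    rw [h3] at h2
    linarith
  have hfin := hineq x hxb P hP0 hφP
  exact lt_irrefl (0:ℝ) (gradBernstein_alg (by positivity) hN0 rfl hlapy hlapx hsum hfin (by
    refine le_trans ?_ hN3
    have := Real.rpow_le_rpow hP0 hPΛ (by linarith : 0 ≤ p)
    linarith))

lemma le_of_sq_le_sq2 {a b : ℝ} (h : a ^ 2 ≤ b ^ 2) (hb : 0 ≤ b) : a ≤ b :=
  abs_le_of_sq_le_sq h hb |> fun h => (le_abs_self a).trans h

lemma LineD2.rpow {f : ℝ → ℝ} {a b s : ℝ} (q : ℝ) (hf : LineD2 f a b) (hs : f 0 = s) (hs0 : 0 < s) :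
    LineD2 (fun t => f t ^ q) (q * s ^ (q - 1) * a)
      (q * (q - 1) * s ^ (q - 2) * a ^ 2 + q * s ^ (q - 1) * b) := by
  obtain ⟨f', h1, h2, h3⟩ := hf
  have h10 := h1.self_of_nhds
  have hpos : ∀ᶠ t in 𝓝 (0:ℝ), 0 < f t := h10.continuousAt.eventually (lt_mem_nhds (by rw [hs]; exact hs0))
  refine ⟨fun t => f' t * q * f t ^ (q - 1), ?_, by simp only [h2, hs]; ring, ?_⟩
  · filter_upwards [h1, hpos] with t ht hp
    exact ht.rpow_const (Or.inl hp.ne')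
  · have h4 := h10.rpow_const (p := q - 1) (Or.inl (by rw [hs]; exact hs0.ne'))
    have h5 := (h3.mul_const q).mul h4
    refine h5.congr_deriv ?_
    rw [h2, hs, show q - 1 - 1 = q - 2 by ring]
    ring

lemma halfSpace_isOpen (n : ℕ) : IsOpen (halfSpace n) := by
  unfold halfSpace
  exact isOpen_lt continuous_const (by fun_prop)

lemma coord_le {n : ℕ} (x y : EuclideanSpace ℝ (Fin (n + 1))) (i : Fin (n + 1)) :
    |x i - y i| ≤ ‖x - y‖ := by
  have := PiLp.norm_apply_le (x - y) i
  simpa using this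

set_option maxHeartbeats 2000000 in
lemma grad_bound (n : ℕ) (p : ℝ) (hp1 : 1 < p) : ∃ C : ℝ, 0 < C ∧
    ∀ u : EuclideanSpace ℝ (Fin (n + 1)) → ℝ, ContDiffOn ℝ 2 u (halfSpace n) →
    (∀ x ∈ halfSpace n, -laplacian u x = ‖gradient u x‖ ^ p) →
    ∀ c ∈ halfSpace n, ‖gradient u c‖ ≤ C * (c (Fin.last n)) ^ (-(1 / (p - 1))) := by
  have hp0 : 0 < p - 1 := by linarith
  set γ : ℝ := 1 / (p - 1) with hγ
  have hγ0 : 0 < γ := by positivity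
  set b : ℝ := 2 * γ with hb
  have hb0 : 0 < b := by positivity
  set C1 : ℝ := 4 * b * (b + 1) + 2 * b * ((n : ℝ) + 1) with hC1
  have hC10 : 0 < C1 := by positivity
  set β : ℝ := 2 * ((n : ℝ) + 1) * (2 * p * b + C1) + 1 with hβ
  have hβ1 : 1 ≤ β := by
    have : 0 ≤ 2 * ((n : ℝ) + 1) * (2 * p * b + C1) := by positivity
    linarith
  have hβ0 : 0 < β := by linarith
  set B : ℝ := β ^ γ with hB
  have hB0 : 0 < B := by positivity
  have hBβ : B ^ (p - 1) = β := by
    rw [hB, ← Real.rpow_mul hβ0.le, hγ]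
    have : 1 / (p - 1) * (p - 1) = 1 := by field_simp
    rw [this, Real.rpow_one]
  refine ⟨2 * B * 2 ^ γ, by positivity, ?_⟩
  intro u hu heq c hc
  have hc0 : 0 < c (Fin.last n) := hc
  set R : ℝ := c (Fin.last n) / 2 with hR
  have hR0 : 0 < R := by positivity
  let s : EuclideanSpace ℝ (Fin (n + 1)) → ℝ := fun x => R ^ 2 - ‖x - c‖ ^ 2
  have hs0 : ∀ x ∈ Metric.ball c R, 0 < s x := by
    intro x hx
    rw [mem_ball_iff_norm] at hx
    have : ‖x - c‖ ^ 2 < R ^ 2 := by gcongr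
    simp only [s]; linarith
  have hsR : ∀ x, s x ≤ R ^ 2 := fun x => by
    have : 0 ≤ ‖x - c‖ ^ 2 := by positivity
    simp only [s]; linarith
  let φ : EuclideanSpace ℝ (Fin (n + 1)) → ℝ := fun x => B ^ 2 * R ^ b * (s x) ^ (-b)
  have hφeq : ∀ x ∈ Metric.ball c R, φ x = B ^ 2 * (R / s x) ^ b := by
    intro x hx
    have := hs0 x hx
    simp only [φ]
    rw [Real.div_rpow hR0.le this.le, Real.rpow_neg this.le]
    ring
  have hmain := gradBernstein hp1 (halfSpace_isOpen n) hu heq c (R := R) (R' := 3 / 2 * R) hR0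
    (by linarith)
    (by
      intro x hx
      rw [mem_closedBall_iff_norm] at hx
      have := (abs_le.1 ((coord_le x c (Fin.last n)).trans hx)).1
      show 0 < x (Fin.last n)
      linarith)
    φ
    (by
      refine ContinuousOn.mul continuousOn_const (ContinuousOn.rpow_const (by fun_prop) ?_)
      intro x hx
      exact Or.inl (hs0 x hx).ne')
    (B ^ 2 * (R / R ^ 2) ^ b) (by positivity)
    (by
      intro x hx
      rw [hφeq x hx]
      have := hs0 x hx
      have := hsR x
      gcongr)
    (by
      intro M
      set M' := max M 1 with hM'
      have hM0 : 0 < M' := lt_of_lt_of_le one_pos (le_max_right _ _)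
      set k : ℝ := (M' / B ^ 2) ^ (1 / b) with hk
      have hk0 : 0 < k := by positivity
      have hkb : k ^ b = M' / B ^ 2 := by
        rw [hk, ← Real.rpow_mul (by positivity)]
        have : 1 / b * b = 1 := by field_simp
        rw [this, Real.rpow_one]
      set s1 : ℝ := min (R ^ 2) (R / (k + 1)) with hs1
      have hs10 : 0 < s1 := by positivity
      refine ⟨√(R ^ 2 - s1), Real.sqrt_nonneg _, ?_, ?_⟩
      · rw [Real.sqrt_lt' hR0]; linarith
      · intro x hx hd
        rw [hφeq x hx]
        have h0 := hs0 x hx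
        have h1 : s x ≤ s1 := by
          rw [dist_eq_norm] at hd
          have h2 : R ^ 2 - s1 ≤ ‖x - c‖ ^ 2 := by
            rw [← Real.sqrt_le_left (norm_nonneg _)]; exact hd
          simp only [s]; linarith
        have h2 : k < R / s x := by
          rw [lt_div_iff₀ h0]
          have h3 : s x ≤ R / (k + 1) := h1.trans (min_le_right _ _)
          rw [le_div_iff₀ (by positivity)] at h3
          linarith
        have h3 : k ^ b < (R / s x) ^ b := Real.rpow_lt_rpow hk0.le h2 hb0
        rw [hkb, div_lt_iff₀ (by positivity)] at h3
        have := le_max_left M 1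
        linarith)
    (fun x => (2 * b * φ x / s x) • (x - c))
    (fun x i => φ x * (4 * b * (b + 1) * ((x - c) i) ^ 2 / (s x) ^ 2 + 2 * b / s x))
    (by
      intro x hx i
      have h0 := hs0 x hx
      have l1 := LineD2.quad (s x) (-(2 * (x - c) i)) (-1)
      have l2 := (l1.rpow (-b) (s := s x) (by simp) h0).const_mul (B ^ 2 * R ^ b)
      have e1 : s x ^ (-b - 1) = s x ^ (-b) / s x := by rw [Real.rpow_sub_one h0.ne']
      have e2 : s x ^ (-b - 2) = s x ^ (-b) / (s x) ^ 2 := by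
        rw [Real.rpow_sub h0]; norm_num
      rw [e1, e2] at l2
      have l3 := l2.congr
        (a' := ((2 * b * φ x / s x) • (x - c)) i)
        (b' := φ x * (4 * b * (b + 1) * ((x - c) i) ^ 2 / (s x) ^ 2 + 2 * b / s x))
        (by simp only [φ, PiLp.smul_apply, smul_eq_mul]; ring)
        (by simp only [φ]; field_simp; ring)
      convert l3 using 2 with t
      simp only [φ]
      congr 2
      simp only [s]
      rw [show x + t • EuclideanSpace.single i (1:ℝ) - c = (x - c) + t • EuclideanSpace.single i (1:ℝ) by
        abel, norm_line_sq]
      ring)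
    (by
      intro x hx P hP hφP
      have h0 := hs0 x hx
      have hyR : ‖x - c‖ ≤ R := by rw [mem_ball_iff_norm] at hx; exact hx.le
      set q : ℝ := R / s x with hq
      have hq0 : 0 < q := by positivity
      have hφ0 : 0 < φ x := by simp only [φ]; positivity
      set Z : ℝ := P ^ (p - 1) with hZ
      have hBq : B * q ^ γ ≤ P := by
        apply le_of_sq_le_sq2 _ hP
        rw [mul_pow, ← Real.rpow_natCast (q ^ γ) 2, ← Real.rpow_mul hq0.le]
        have : γ * ((2 : ℕ) : ℝ) = b := by rw [hb]; push_cast; ring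
        rw [this, ← hφeq x hx]
        exact hφP
      have hP0 : 0 < P := lt_of_lt_of_le (by positivity) hBq
      have hZ0 : 0 < Z := by positivity
      have hqZ : q ≤ Z / β := by
        rw [le_div_iff₀ hβ0]
        have h1 := Real.rpow_le_rpow (by positivity) hBq hp0.le
        rw [Real.mul_rpow hB0.le (by positivity), hBβ, ← Real.rpow_mul hq0.le] at h1
        have : γ * (p - 1) = 1 := by rw [hγ]; field_simp
        rw [this, Real.rpow_one] at h1
        linarith
      have hPp : P ^ p = P * Z := by
        rw [hZ, mul_comm, ← Real.rpow_add_one hP0.ne']; congr 1; ring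
      have hG : ‖(2 * b * φ x / s x) • (x - c)‖ ≤ 2 * b * P ^ 2 * (Z / β) := by
        rw [norm_smul, Real.norm_of_nonneg (by positivity)]
        calc 2 * b * φ x / s x * ‖x - c‖ ≤ 2 * b * φ x / s x * R := by gcongr
          _ = 2 * b * φ x * q := by rw [hq]; ring
          _ ≤ _ := by gcongr
      have hH : ∑ i, φ x * (4 * b * (b + 1) * ((x - c) i) ^ 2 / (s x) ^ 2 + 2 * b / s x)
          ≤ P ^ 2 * (C1 * (Z / β) ^ 2) := by
        have h1 : ∑ i, φ x * (4 * b * (b + 1) * ((x - c) i) ^ 2 / (s x) ^ 2 + 2 * b / s x)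
            = φ x * (4 * b * (b + 1) * ‖x - c‖ ^ 2 / (s x) ^ 2 + 2 * b * ((n:ℝ) + 1) / s x) := by
          rw [← Finset.mul_sum, Finset.sum_add_distrib, EuclideanSpace.norm_sq_eq]
          simp only [Finset.sum_const, Finset.card_univ, Fintype.card_fin, nsmul_eq_mul,
            Real.norm_eq_abs, sq_abs]
          rw [← Finset.sum_div, ← Finset.mul_sum]
          push_cast
          ring
        rw [h1]
        have h2 : ‖x - c‖ ^ 2 / (s x) ^ 2 ≤ q ^ 2 := by rw [hq, div_pow]; gcongr
        have h3 : 1 / s x ≤ q ^ 2 := by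
          rw [hq, div_pow, div_le_div_iff₀ h0 (by positivity)]
          have := mul_le_mul_of_nonneg_right (hsR x) h0.le
          nlinarith
        calc φ x * (4 * b * (b + 1) * ‖x - c‖ ^ 2 / (s x) ^ 2 + 2 * b * ((n:ℝ) + 1) / s x)
            = φ x * (4 * b * (b + 1) * (‖x - c‖ ^ 2 / (s x) ^ 2) + 2 * b * ((n:ℝ) + 1) * (1 / s x)) := by
              ring
          _ ≤ φ x * (4 * b * (b + 1) * q ^ 2 + 2 * b * ((n:ℝ) + 1) * q ^ 2) := by gcongr
          _ = φ x * (C1 * q ^ 2) := by rw [hC1]; ring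
          _ ≤ _ := by gcongr
      have hfin : p * Z * (2 * b * P ^ 2 * (Z / β)) + P ^ 2 * (C1 * (Z / β) ^ 2)
          < (P * Z) ^ 2 / (2 * ((n:ℝ) + 1)) := by
        have e1 : p * Z * (2 * b * P ^ 2 * (Z / β)) + P ^ 2 * (C1 * (Z / β) ^ 2)
            = (P * Z) ^ 2 * (2 * p * b / β + C1 / β ^ 2) := by ring
        have e2 : 2 * p * b / β + C1 / β ^ 2 < 1 / (2 * ((n:ℝ) + 1)) := by
          have : C1 / β ^ 2 ≤ C1 / β := by
            gcongr
            nlinarith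
          have h5 : (2 * p * b + C1) / β < 1 / (2 * ((n:ℝ) + 1)) := by
            rw [div_lt_div_iff₀ hβ0 (by positivity)]
            rw [hβ]; linarith
          rw [add_div] at h5
          linarith
        rw [e1, div_eq_mul_one_div ((P * Z) ^ 2)]
        exact mul_lt_mul_of_pos_left e2 (by positivity)
      rw [hPp]
      refine lt_of_le_of_lt (add_le_add ?_ hH) hfin
      gcongr)
  have hcb : c ∈ Metric.ball c R := Metric.mem_ball_self hR0
  rw [hφeq c hcb] at hmain
  have hsc : s c = R ^ 2 := by simp [s]
  rw [hsc] at hmain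
  apply le_of_sq_le_sq2 _ (by positivity)
  have e1 : R / R ^ 2 = 2 * (c (Fin.last n))⁻¹ := by rw [hR]; field_simp
  have e2 : (R / R ^ 2) ^ b = (2 ^ γ * (c (Fin.last n)) ^ (-γ)) ^ 2 := by
    rw [e1, Real.rpow_neg hc0.le, ← Real.inv_rpow hc0.le, ← Real.mul_rpow (by norm_num) (by positivity),
      ← Real.rpow_natCast, ← Real.rpow_mul (by positivity)]
    congr 1
    rw [hb]; push_cast; ring
  rw [e2] at hmain
  calc _ ≤ _ := hmain
    _ ≤ 4 * (B ^ 2 * (2 ^ γ * (c (Fin.last n)) ^ (-γ)) ^ 2) := by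
        have : 0 ≤ B ^ 2 * (2 ^ γ * (c (Fin.last n)) ^ (-γ)) ^ 2 := by positivity
        linarith
    _ = _ := by ring

lemma vertical_bound {n : ℕ} {a C : ℝ} (ha : 0 < a) (hC : 0 < C)
    {u : EuclideanSpace ℝ (Fin (n + 1)) → ℝ} (hu : ContDiffOn ℝ 2 u (halfSpace n))
    (hg : ∀ x ∈ halfSpace n, ‖gradient u x‖ ≤ C * (x (Fin.last n)) ^ (-(a + 1)))
    (x : EuclideanSpace ℝ (Fin (n + 1))) (hx : x ∈ halfSpace n) (T : ℝ) (hT : 0 ≤ T) :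
    |u (x + T • EuclideanSpace.single (Fin.last n) 1) - u x| ≤ C / a * (x (Fin.last n)) ^ (-a) := by
  set e : EuclideanSpace ℝ (Fin (n + 1)) := EuclideanSpace.single (Fin.last n) 1 with he
  set s := x (Fin.last n) with hs
  have hs0 : 0 < s := hx
  have hcoord : ∀ t : ℝ, (x + t • e) (Fin.last n) = s + t := by
    intro t; simp [he, hs]
  have hmem : ∀ t : ℝ, 0 ≤ t → x + t • e ∈ halfSpace n := by
    intro t ht
    show 0 < (x + t • e) (Fin.last n)
    rw [hcoord]; linarith
  have hder : ∀ t : ℝ, 0 ≤ t → HasDerivAt (fun t : ℝ => u (x + t • e) - u x)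
      (fderiv ℝ u (x + t • e) e) t := by
    intro t ht
    have h1 : DifferentiableAt ℝ u (x + t • e) :=
      (hu.contDiffAt ((halfSpace_isOpen n).mem_nhds (hmem t ht))).differentiableAt (by norm_num)
    have h2 : HasDerivAt (fun t : ℝ => x + t • e) e t := by
      simpa using ((hasDerivAt_id t).smul_const e).const_add x
    exact (h1.hasFDerivAt.comp_hasDerivAt t h2).sub_const _
  have hBder : ∀ t : ℝ, 0 ≤ t → HasDerivAt (fun t : ℝ => C / a * (s ^ (-a) - (s + t) ^ (-a)))
      (C * (s + t) ^ (-(a + 1))) t := by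
    intro t ht
    have h1 : HasDerivAt (fun t : ℝ => s + t) 1 t := (hasDerivAt_id t).const_add s
    have h2 := ((h1.rpow_const (p := -a) (Or.inl (by linarith))).const_sub (s ^ (-a))).const_mul (C / a)
    refine h2.congr_deriv ?_
    rw [show -a - 1 = -(a + 1) by ring]
    field_simp
  have := image_norm_le_of_norm_deriv_right_le_deriv_boundary' (a := 0) (b := T)
    (f := fun t : ℝ => u (x + t • e) - u x) (f' := fun t => fderiv ℝ u (x + t • e) e)
    (fun t ht => (hder t ht.1).continuousAt.continuousWithinAt)
    (fun t ht => (hder t ht.1).hasDerivWithinAt)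
    (B := fun t : ℝ => C / a * (s ^ (-a) - (s + t) ^ (-a))) (B' := fun t => C * (s + t) ^ (-(a + 1)))
    (by simp)
    (fun t ht => (hBder t ht.1).continuousAt.continuousWithinAt)
    (fun t ht => (hBder t ht.1).hasDerivWithinAt)
    (fun t ht => by
      have h1 := hg _ (hmem t ht.1)
      rw [hcoord, norm_gradient_eq] at h1
      have h2 := (fderiv ℝ u (x + t • e)).le_opNorm e
      have h3 : ‖e‖ = 1 := by simp [he]
      rw [h3, mul_one] at h2
      exact h2.trans h1)
    (right_mem_Icc.2 hT)
  refine (show |u (x + T • e) - u x| ≤ _ from this).trans ?_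
  have : 0 ≤ (s + T) ^ (-a) := Real.rpow_nonneg (by linarith) _
  have : 0 < C / a := by positivity
  apply mul_le_mul_of_nonneg_left _ this.le
  linarith

lemma growth_bound {n : ℕ} {a C : ℝ} (ha : 0 < a) (hC : 0 < C)
    {u : EuclideanSpace ℝ (Fin (n + 1)) → ℝ} (hu : ContDiffOn ℝ 2 u (halfSpace n))
    (hg : ∀ x ∈ halfSpace n, ‖gradient u x‖ ≤ C * (x (Fin.last n)) ^ (-(a + 1))) :
    ∃ L : ℝ, ∀ x ∈ halfSpace n, |u x| ≤ L + C / a * (x (Fin.last n)) ^ (-a) := by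
  set e : EuclideanSpace ℝ (Fin (n + 1)) := EuclideanSpace.single (Fin.last n) 1 with he
  have hemem : e ∈ halfSpace n := by
    show 0 < e (Fin.last n)
    simp [he]
  refine ⟨|u e| + C / a + 2 * C, fun x hx => ?_⟩
  have hx0 : 0 < x (Fin.last n) := hx
  set T : ℝ := ‖x‖ + 1 with hT
  have hT1 : 1 ≤ T := by have := norm_nonneg x; linarith
  have h1 := vertical_bound ha hC hu hg x hx T (by linarith)
  have h2 := vertical_bound ha hC hu hg e hemem T (by linarith)
  rw [← he] at h1 h2
  have he1 : e (Fin.last n) = 1 := by simp [he]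
  rw [he1, Real.one_rpow, mul_one] at h2
  have h3 : ‖u (x + T • e) - u (e + T • e)‖ ≤ (C * T ^ (-(a + 1))) * ‖(x + T • e) - (e + T • e)‖ := by
    refine Convex.norm_image_sub_le_of_norm_fderiv_le (𝕜 := ℝ) (s := {y | T ≤ y (Fin.last n)})
      ?_ ?_ ?_ ?_ ?_
    · intro y hy
      have : y ∈ halfSpace n := lt_of_lt_of_le (show (0:ℝ) < T by linarith) hy
      exact (hu.contDiffAt ((halfSpace_isOpen n).mem_nhds this)).differentiableAt (by norm_num)
    · intro y hy
      have hy' : T ≤ y (Fin.last n) := hy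
      have : y ∈ halfSpace n := lt_of_lt_of_le (show (0:ℝ) < T by linarith) hy
      rw [← norm_gradient_eq]
      refine (hg y this).trans ?_
      apply mul_le_mul_of_nonneg_left _ hC.le
      exact Real.rpow_le_rpow_of_nonpos (by linarith) hy' (by linarith)
    · intro y hy z hz α β hα hβ hαβ
      have hy' : T ≤ y (Fin.last n) := hy
      have hz' : T ≤ z (Fin.last n) := hz
      show T ≤ (α • y + β • z) (Fin.last n)
      simp only [PiLp.add_apply, PiLp.smul_apply, smul_eq_mul]
      calc T = α * T + β * T := by rw [← add_mul, hαβ, one_mul]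
        _ ≤ _ := by gcongr
    · show T ≤ (e + T • e) (Fin.last n)
      simp [he]
    · show T ≤ (x + T • e) (Fin.last n)
      simp [he, hx0.le]
  have h4 : ‖(x + T • e) - (e + T • e)‖ ≤ 2 * T := by
    rw [add_sub_add_right_eq_sub]
    refine (norm_sub_le _ _).trans ?_
    have : ‖e‖ = 1 := by simp [he]
    rw [this]; linarith
  have h5 : T ^ (-(a + 1)) ≤ T⁻¹ := by
    rw [← Real.rpow_neg_one]
    exact Real.rpow_le_rpow_of_exponent_le hT1 (by linarith)
  have h6 : (C * T ^ (-(a + 1))) * ‖(x + T • e) - (e + T • e)‖ ≤ 2 * C := by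
    calc _ ≤ (C * T⁻¹) * (2 * T) := by gcongr
      _ = 2 * C := by
        have : T ≠ 0 := by linarith
        field_simp
  have h7 : |u (x + T • e) - u (e + T • e)| ≤ 2 * C := h3.trans h6
  rw [abs_le] at *
  have := le_abs_self (u e)
  have := neg_abs_le (u e)
  constructor <;> linarith [h1.1, h1.2, h2.1, h2.2, h7.1, h7.2]

lemma closure_halfSpace_eq (n : ℕ) : closure (halfSpace n) = {x | 0 ≤ x (Fin.last n)} := by
  apply Subset.antisymm
  · apply closure_minimal
    · intro x hx; exact le_of_lt (show 0 < x (Fin.last n) from hx)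
    · exact isClosed_le continuous_const (by fun_prop)
  · intro x hx
    have hx' : 0 ≤ x (Fin.last n) := hx
    have h1 : Tendsto (fun t : ℝ => x + t • EuclideanSpace.single (Fin.last n) (1:ℝ)) (𝓝[>] 0) (𝓝 x) := by
      have : Continuous (fun t : ℝ => x + t • EuclideanSpace.single (Fin.last n) (1:ℝ)) := by fun_prop
      have h2 := this.tendsto 0
      simp only [zero_smul, add_zero] at h2
      exact h2.mono_left nhdsWithin_le_nhds
    refine mem_closure_of_tendsto h1 ?_
    filter_upwards [self_mem_nhdsWithin] with t ht
    have ht' : 0 < t := ht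
    show 0 < (x + t • EuclideanSpace.single (Fin.last n) (1:ℝ)) (Fin.last n)
    simp
    linarith

lemma eta_exists {p θ d : ℝ} (hp1 : 1 < p) (hθ : 0 < θ) (hd : 1 ≤ d) :
    ∃ η : ℝ, 0 < η ∧ η * d ≤ 1 ∧ η ≤ 1 ∧ (2 * η / θ) ^ p < η / θ ^ 2 := by
  have hp0 : 0 < p - 1 := by linarith
  set k : ℝ := (θ / 2) ^ p / θ ^ 2 with hk
  have hk0 : 0 < k := by positivity
  have hd0 : 0 < d := by linarith
  set η : ℝ := min (1 / d) ((k / 2) ^ (1 / (p - 1))) with hη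
  have hη0 : 0 < η := by positivity
  have h1 : η * d ≤ 1 := by
    have : η ≤ 1 / d := min_le_left _ _
    rwa [le_div_iff₀ hd0] at this
  refine ⟨η, hη0, h1, by nlinarith, ?_⟩
  have h2 : η ^ (p - 1) ≤ k / 2 := by
    calc η ^ (p - 1) ≤ ((k / 2) ^ (1 / (p - 1))) ^ (p - 1) :=
          Real.rpow_le_rpow hη0.le (min_le_right _ _) hp0.le
      _ = k / 2 := by
        rw [← Real.rpow_mul (by positivity)]
        have : 1 / (p - 1) * (p - 1) = 1 := by field_simp
        rw [this, Real.rpow_one]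
  have h3 : η ^ p = η ^ (p - 1) * η := by
    rw [← Real.rpow_add_one hη0.ne']; congr 1; ring
  have h4 : (2 * η / θ) ^ p = η ^ p / (θ / 2) ^ p := by
    rw [← Real.div_rpow hη0.le (by positivity)]; congr 1; field_simp
  rw [h4, div_lt_iff₀ (by positivity), h3]
  calc η ^ (p - 1) * η ≤ k / 2 * η := by gcongr
    _ < k * η := by gcongr; linarith
    _ = _ := by rw [hk]; ring

lemma barrier_contra {n : ℕ} {p : ℝ} (hp1 : 1 < p)
    {g : EuclideanSpace ℝ (Fin (n + 1)) → ℝ} (hg2 : ContDiffOn ℝ 2 g (halfSpace n))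
    (hgc : ContinuousOn g (closure (halfSpace n)))
    (hsub : ∀ x ∈ halfSpace n, -laplacian g x ≤ ‖gradient g x‖ ^ p)
    (hbc : ∀ x : EuclideanSpace ℝ (Fin (n + 1)), x (Fin.last n) = 0 → g x = 0)
    (x0 : EuclideanSpace ℝ (Fin (n + 1))) {m T ρ η B : ℝ} (hm : 0 < m) (hT : 0 < T) (hρ : 0 < ρ)
    (hη : 0 < η) (hη1 : η ≤ 1) (hB : 0 < B)
    (hx0 : 0 < x0 (Fin.last n)) (hx0T : x0 (Fin.last n) < T) (hgx0 : g x0 = m)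
    (htop : ∀ x : EuclideanSpace ℝ (Fin (n + 1)), x (Fin.last n) = T → g x ≤ m / 2)
    (hlat : ∀ x : EuclideanSpace ℝ (Fin (n + 1)), 0 ≤ x (Fin.last n) → ‖x - x0‖ ≤ ρ → g x ≤ B * m) :
    2 * (η * m / T ^ 2) - 2 * (B * m / ρ ^ 2) * ((n : ℝ) + 1) ≤ (η * m / T + 2 * B * m / ρ) ^ p := by
  set e : EuclideanSpace ℝ (Fin (n + 1)) := EuclideanSpace.single (Fin.last n) 1 with he
  let w : EuclideanSpace ℝ (Fin (n + 1)) → ℝ := fun x =>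
    m / 2 + η * m / T ^ 2 * (x (Fin.last n) * (T - x (Fin.last n))) + B * m / ρ ^ 2 * ‖x - x0‖ ^ 2
  let D : Set (EuclideanSpace ℝ (Fin (n + 1))) :=
    {x | 0 ≤ x (Fin.last n)} ∩ {x | x (Fin.last n) ≤ T} ∩ Metric.closedBall x0 ρ
  have hDc : IsCompact D := by
    refine (isCompact_closedBall x0 ρ).inter_left (IsClosed.inter ?_ ?_)
    · exact isClosed_le continuous_const (by fun_prop)
    · exact isClosed_le (by fun_prop) continuous_const
  have hx0D : x0 ∈ D := ⟨⟨hx0.le, hx0T.le⟩, Metric.mem_closedBall_self hρ.le⟩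
  have hfc : ContinuousOn (fun x => g x - w x) D := by
    refine ContinuousOn.sub (hgc.mono ?_) ?_
    · rw [closure_halfSpace_eq]
      exact fun x hx => hx.1.1
    · exact Continuous.continuousOn (by simp only [w]; fun_prop)
  obtain ⟨z, hzD, hzmax⟩ := hDc.exists_isMaxOn ⟨_, hx0D⟩ hfc
  have hpos0 : 0 < g x0 - w x0 := by
    simp only [w]
    rw [hgx0, sub_self, norm_zero]
    have h1 : x0 (Fin.last n) * (T - x0 (Fin.last n)) ≤ T ^ 2 / 4 := by
      nlinarith [sq_nonneg (x0 (Fin.last n) - T / 2)]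
    have h2 : η * m / T ^ 2 * (x0 (Fin.last n) * (T - x0 (Fin.last n))) ≤ η * m / T ^ 2 * (T ^ 2 / 4) := by
      gcongr
    have h3 : η * m / T ^ 2 * (T ^ 2 / 4) = η * m / 4 := by field_simp
    have h4 : η * m ≤ 1 * m := by gcongr
    simp
    linarith
  have hpos : 0 < g z - w z := hpos0.trans_le (hzmax hx0D)
  obtain ⟨⟨hz0, hzT⟩, hzb⟩ := hzD
  have hz0 : 0 ≤ z (Fin.last n) := hz0
  have hzT : z (Fin.last n) ≤ T := hzT
  have hzρ : ‖z - x0‖ ≤ ρ := by rwa [mem_closedBall_iff_norm] at hzb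
  have hq0 : 0 ≤ η * m / T ^ 2 * (z (Fin.last n) * (T - z (Fin.last n))) := by
    have : 0 ≤ T - z (Fin.last n) := by linarith
    positivity
  have hr0 : 0 ≤ B * m / ρ ^ 2 * ‖z - x0‖ ^ 2 := by positivity
  have hwz : w z = m / 2 + η * m / T ^ 2 * (z (Fin.last n) * (T - z (Fin.last n)))
    + B * m / ρ ^ 2 * ‖z - x0‖ ^ 2 := rfl
  have hz0' : 0 < z (Fin.last n) := by
    rcases hz0.eq_or_lt with h | h
    · have := hbc z h.symm
      linarith
    · exact h
  have hzT' : z (Fin.last n) < T := by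
    rcases hzT.eq_or_lt with h | h
    · have := htop z h
      linarith
    · exact h
  have hzρ' : ‖z - x0‖ < ρ := by
    rcases hzρ.eq_or_lt with h | h
    · have h1 := hlat z hz0 hzρ
      rw [h] at hwz
      have : B * m / ρ ^ 2 * ρ ^ 2 = B * m := by field_simp
      linarith
    · exact h
  have ho1 : IsOpen {x : EuclideanSpace ℝ (Fin (n+1)) | 0 < x (Fin.last n)} :=
    isOpen_lt continuous_const (by fun_prop)
  have ho2 : IsOpen {x : EuclideanSpace ℝ (Fin (n+1)) | x (Fin.last n) < T} :=
    isOpen_lt (by fun_prop) continuous_const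
  have hDn : D ∈ 𝓝 z := by
    refine inter_mem (inter_mem ?_ ?_) ?_
    · exact mem_of_superset (ho1.mem_nhds hz0')
        (fun x (hx : 0 < x (Fin.last n)) => hx.le)
    · exact mem_of_superset (ho2.mem_nhds hzT')
        (fun x (hx : x (Fin.last n) < T) => hx.le)
    · exact mem_of_superset (Metric.isOpen_ball.mem_nhds (by rwa [mem_ball_iff_norm]))
        Metric.ball_subset_closedBall
  have hzH : z ∈ halfSpace n := hz0'
  have hCz : ContDiffAt ℝ 2 g z := hg2.contDiffAt ((halfSpace_isOpen n).mem_nhds hzH)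
  have key : ∀ i : Fin (n + 1),
      (gradient g z i - (η * m / T ^ 2 * (T - 2 * z (Fin.last n)) * e i
          + B * m / ρ ^ 2 * (2 * (z - x0) i)) = 0) ∧
      (iteratedFDeriv ℝ 2 g z ![EuclideanSpace.single i 1, EuclideanSpace.single i 1]
        - 2 * (-(η * m / T ^ 2) * (e i) ^ 2 + B * m / ρ ^ 2) ≤ 0) := by
    intro i
    have l1 := lineD2_of_contDiffAt hCz (EuclideanSpace.single i 1)
    have l2 := LineD2.quad (w z) (η * m / T ^ 2 * (T - 2 * z (Fin.last n)) * e i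
          + B * m / ρ ^ 2 * (2 * (z - x0) i)) (-(η * m / T ^ 2) * (e i) ^ 2 + B * m / ρ ^ 2)
    have l3 := (l1.sub l2).max (by
      have hc : Continuous (fun t : ℝ => z + t • EuclideanSpace.single i (1:ℝ)) := by fun_prop
      have ht := hc.tendsto 0
      simp only [zero_smul, add_zero] at ht
      filter_upwards [ht.eventually hDn] with t ht
      have h1 : g (z + t • EuclideanSpace.single i (1:ℝ)) - w (z + t • EuclideanSpace.single i (1:ℝ))
        ≤ g z - w z := hzmax ht
      have h2 : w (z + t • EuclideanSpace.single i (1:ℝ)) = w z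
          + (η * m / T ^ 2 * (T - 2 * z (Fin.last n)) * e i + B * m / ρ ^ 2 * (2 * (z - x0) i)) * t
          + (-(η * m / T ^ 2) * (e i) ^ 2 + B * m / ρ ^ 2) * t ^ 2 := by
        have h3 : (z + t • EuclideanSpace.single i (1:ℝ)) (Fin.last n) = z (Fin.last n) + t * e i := by
          simp only [he, PiLp.add_apply, PiLp.smul_apply, smul_eq_mul, EuclideanSpace.single_apply]
          congr 2
          simp only [eq_comm]
        simp only [w]
        rw [h3, show z + t • EuclideanSpace.single i (1:ℝ) - x0
          = (z - x0) + t • EuclideanSpace.single i (1:ℝ) by abel, norm_line_sq]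
        ring
      rw [h2] at h1
      simpa using h1)
    rw [EuclideanSpace.inner_single_right, one_mul] at l3
    exact l3
  have hgrad : gradient g z = (η * m / T ^ 2 * (T - 2 * z (Fin.last n))) • e
      + (2 * B * m / ρ ^ 2) • (z - x0) := by
    ext i
    have := (key i).1
    rw [PiLp.add_apply, PiLp.smul_apply, PiLp.smul_apply, smul_eq_mul, smul_eq_mul]
    rw [sub_eq_zero.1 this]
    ring
  have hgn : ‖gradient g z‖ ≤ η * m / T + 2 * B * m / ρ := by
    rw [hgrad]
    refine (norm_add_le _ _).trans (add_le_add ?_ ?_)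
    · have h1 : ‖e‖ = 1 := by simp [he]
      rw [norm_smul, h1, mul_one, norm_mul, Real.norm_of_nonneg (by positivity), Real.norm_eq_abs]
      have h2 : |T - 2 * z (Fin.last n)| ≤ T := by rw [abs_le]; constructor <;> linarith
      calc η * m / T ^ 2 * |T - 2 * z (Fin.last n)| ≤ η * m / T ^ 2 * T := by gcongr
        _ = η * m / T := by field_simp
    · rw [norm_smul, Real.norm_of_nonneg (by positivity)]
      calc 2 * B * m / ρ ^ 2 * ‖z - x0‖ ≤ 2 * B * m / ρ ^ 2 * ρ := by gcongr
        _ = _ := by field_simp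
  have hlap : laplacian g z ≤ -2 * (η * m / T ^ 2) + 2 * (B * m / ρ ^ 2) * ((n : ℝ) + 1) := by
    have h1 := Finset.sum_nonpos (s := Finset.univ) fun i _ => (key i).2
    rw [Finset.sum_sub_distrib, ← Finset.mul_sum, Finset.sum_add_distrib, ← Finset.mul_sum] at h1
    have h2 : ∑ i, (e i) ^ 2 = 1 := by
      have h3 : ‖e‖ = 1 := by simp [he]
      have := EuclideanSpace.norm_sq_eq e
      rw [h3] at this
      simp only [Real.norm_eq_abs, sq_abs] at this
      rw [← this]; norm_num
    rw [h2] at h1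
    simp only [Finset.sum_const, Finset.card_univ, Fintype.card_fin, nsmul_eq_mul] at h1
    push_cast at h1
    unfold laplacian
    linarith
  have h1 := hsub z hzH
  have h2 := Real.rpow_le_rpow (norm_nonneg _) hgn (by linarith : 0 ≤ p)
  linarith

lemma bounded_above {n : ℕ} {p a C L : ℝ} (hp1 : 1 < p) (ha : 0 < a) (hpa : (p - 1) * (a + 1) = 1)
    (hC : 0 < C)
    {g : EuclideanSpace ℝ (Fin (n + 1)) → ℝ} (hg2 : ContDiffOn ℝ 2 g (halfSpace n))
    (hgc : ContinuousOn g (closure (halfSpace n)))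
    (hsub : ∀ x ∈ halfSpace n, -laplacian g x ≤ ‖gradient g x‖ ^ p)
    (hbc : ∀ x : EuclideanSpace ℝ (Fin (n + 1)), x (Fin.last n) = 0 → g x = 0)
    (hgrow : ∀ x ∈ halfSpace n, g x ≤ L + C * (x (Fin.last n)) ^ (-a)) :
    ∃ M : ℝ, ∀ x ∈ halfSpace n, g x ≤ M := by
  set θ : ℝ := (4 * C) ^ (1 / a) with hθ
  have hθ0 : 0 < θ := by positivity
  have hθa : C * θ ^ (-a) = 1 / 4 := by
    rw [hθ, ← Real.rpow_mul (by positivity)]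
    have : 1 / a * -a = -1 := by field_simp
    rw [this, Real.rpow_neg_one]
    field_simp
  obtain ⟨η, hη0, hηd, hη1, hηp⟩ := eta_exists (d := (n : ℝ) + 1) hp1 hθ0
    (by have : (0:ℝ) ≤ n := Nat.cast_nonneg n
        linarith)
  set B : ℝ := 2 ^ a with hB
  have hB1 : 1 ≤ B := Real.one_le_rpow (by norm_num) ha.le
  have hB0 : 0 < B := by linarith
  set K : ℝ := 2 * B * θ / η with hK
  have hK0 : 0 < K := by positivity
  refine ⟨max ((2 * K) ^ a) (4 * |L| + 1), ?_⟩
  by_contra! hcon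
  obtain ⟨y, hyH, hy⟩ := hcon
  have hy1 : (2 * K) ^ a < g y := lt_of_le_of_lt (le_max_left _ _) hy
  have hy2 : 4 * |L| + 1 < g y := lt_of_le_of_lt (le_max_right _ _) hy
  have hL0 := abs_nonneg L
  have hgy : 0 < g y := by linarith
  let S : Set (EuclideanSpace ℝ (Fin (n + 1))) := closure (halfSpace n) ∩ Metric.closedBall y 1
  have hSc : IsCompact S := (isCompact_closedBall y 1).inter_left isClosed_closure
  have hyS : y ∈ S := ⟨subset_closure hyH, Metric.mem_closedBall_self zero_le_one⟩
  have hfc : ContinuousOn (fun x => g x * (1 - ‖x - y‖) ^ a) S := by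
    refine (hgc.mono inter_subset_left).mul ?_
    refine ContinuousOn.rpow_const (by fun_prop) fun x _ => Or.inr ha.le
  obtain ⟨x0, hx0S, hx0max⟩ := hSc.exists_isMaxOn ⟨_, hyS⟩ hfc
  set m := g x0 with hm
  set ψ := 1 - ‖x0 - y‖ with hψ
  have hmy : g y ≤ m * ψ ^ a := by
    have : g y * (1 - ‖y - y‖) ^ a ≤ g x0 * (1 - ‖x0 - y‖) ^ a := hx0max hyS
    simpa using this
  have hψ0 : 0 ≤ ψ := by
    have := hx0S.2
    rw [mem_closedBall_iff_norm] at this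
    linarith
  have hψ1 : ψ ≤ 1 := by have := norm_nonneg (x0 - y); linarith
  have hψpos : 0 < ψ := by
    rcases hψ0.eq_or_lt with h | h
    · rw [← h, Real.zero_rpow ha.ne'] at hmy
      linarith
    · exact h
  have hψa : ψ ^ a ≤ 1 := Real.rpow_le_one hψ0 hψ1 ha.le
  have hψa0 : 0 < ψ ^ a := by positivity
  have hm0 : 0 < m := by
    by_contra! h
    have := mul_nonpos_of_nonpos_of_nonneg h hψa0.le
    linarith
  have hmge : g y ≤ m := hmy.trans (by nlinarith)
  set τ : ℝ := m ^ (-(1 / a)) with hτ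
  have hτ0 : 0 < τ := by positivity
  have hτm : τ ^ (-a) = m := by
    rw [hτ, ← Real.rpow_mul hm0.le]
    have : -(1 / a) * -a = 1 := by field_simp
    rw [this, Real.rpow_one]
  have hKψ : 2 * K * τ < ψ := by
    have h1 : (2 * K) ^ a < (ψ / τ) ^ a := by
      rw [Real.div_rpow hψ0 hτ0.le, div_eq_mul_inv, ← Real.rpow_neg hτ0.le, hτm]
      linarith
    have h2 := (Real.rpow_lt_rpow_iff (by positivity) (by positivity) ha).1 h1
    rwa [lt_div_iff₀ hτ0] at h2
  have hx0c : 0 ≤ x0 (Fin.last n) := by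
    have := hx0S.1
    rw [closure_halfSpace_eq] at this
    exact this
  have hx0pos : 0 < x0 (Fin.last n) := by
    rcases hx0c.eq_or_lt with h | h
    · have := hbc x0 h.symm
      linarith
    · exact h
  have hhigh : ∀ x : EuclideanSpace ℝ (Fin (n + 1)), θ * τ ≤ x (Fin.last n) → g x ≤ m / 2 := by
    intro x hx
    have hpos : 0 < θ * τ := by positivity
    have hxH : x ∈ halfSpace n := lt_of_lt_of_le hpos hx
    have h1 := hgrow x hxH
    have h2 : (x (Fin.last n)) ^ (-a) ≤ (θ * τ) ^ (-a) :=
      Real.rpow_le_rpow_of_nonpos hpos hx (by linarith)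
    rw [Real.mul_rpow hθ0.le hτ0.le, hτm] at h2
    have h3 : C * (x (Fin.last n)) ^ (-a) ≤ C * (θ ^ (-a) * m) := by gcongr
    have h4 : C * (θ ^ (-a) * m) = m / 4 := by rw [← mul_assoc, hθa]; ring
    have := le_abs_self L
    linarith
  have hfinal := barrier_contra hp1 hg2 hgc hsub hbc x0 (m := m) (T := θ * τ) (ρ := K * τ) (η := η)
    (B := B) hm0 (by positivity) (by positivity) hη0 hη1 hB0 hx0pos
    (by by_contra! h
        have := hhigh x0 h
        linarith)
    rfl (fun x hx => hhigh x hx.ge)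
    (by
      intro x hx hxρ
      by_cases hgx : g x ≤ 0
      · have : 0 ≤ B * m := by positivity
        linarith
      push Not at hgx
      have h1 : ‖x - y‖ ≤ 1 - ψ / 2 := by
        have : x - y = (x - x0) + (x0 - y) := by abel
        rw [this]
        refine (norm_add_le _ _).trans ?_
        linarith
      have hxS : x ∈ S := by
        refine ⟨by rw [closure_halfSpace_eq]; exact hx, ?_⟩
        rw [mem_closedBall_iff_norm]; linarith
      have h2 : g x * (1 - ‖x - y‖) ^ a ≤ m * ψ ^ a := hx0max hxS
      have h3 : (ψ / 2) ^ a ≤ (1 - ‖x - y‖) ^ a :=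
        Real.rpow_le_rpow (by positivity) (by linarith) ha.le
      have h4 : g x * (ψ / 2) ^ a ≤ m * ψ ^ a := le_trans (by gcongr) h2
      rw [Real.div_rpow hψ0 (by norm_num), ← hB] at h4
      have h5 : g x * (ψ ^ a / B) = (g x / B) * ψ ^ a := by ring
      rw [h5] at h4
      have h6 := le_of_mul_le_mul_right h4 hψa0
      rw [div_le_iff₀ hB0] at h6
      linarith)
  have e1 : η * m / (θ * τ) + 2 * B * m / (K * τ) = (2 * η / θ) * (m / τ) := by
    rw [hK]; field_simp; ring
  have e2 : (m / τ) ^ p = m / τ ^ 2 := by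
    have h1 : m / τ = τ ^ (-(a + 1)) := by
      rw [← hτm, ← Real.rpow_sub_one hτ0.ne']; congr 1; ring
    have h2 : m / τ ^ 2 = τ ^ (-(a + 2)) := by
      rw [← hτm, ← Real.rpow_natCast, ← Real.rpow_sub hτ0]; congr 1; push_cast; ring
    rw [h1, h2, ← Real.rpow_mul hτ0.le]
    congr 1
    linear_combination -hpa
  rw [e1, Real.mul_rpow (by positivity) (by positivity), e2] at hfinal
  have e3 : 2 * (η * m / (θ * τ) ^ 2) - 2 * (B * m / (K * τ) ^ 2) * ((n : ℝ) + 1)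
      = (2 * η - η * (η * ((n : ℝ) + 1)) / (2 * B)) / θ ^ 2 * (m / τ ^ 2) := by
    rw [hK]; field_simp
  rw [e3] at hfinal
  have hmt : 0 < m / τ ^ 2 := by positivity
  have h7 := le_of_mul_le_mul_right hfinal hmt
  have h8 : η * (η * ((n : ℝ) + 1)) / (2 * B) ≤ η := by
    rw [div_le_iff₀ (by positivity)]
    have : η * (η * ((n : ℝ) + 1)) ≤ η * 1 := by gcongr
    have : η * 1 ≤ η * (2 * B) := by gcongr; linarith
    linarith
  have h9 : η / θ ^ 2 ≤ (2 * η - η * (η * ((n : ℝ) + 1)) / (2 * B)) / θ ^ 2 := by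
    gcongr; linarith
  linarith

/-- Global boundedness: for `1 < p < 2`, any classical solution of `-Δu = |∇u|^p`
in the half-space with zero boundary data is bounded. -/
theorem global_boundedness (n : ℕ) (p : ℝ) (hp1 : 1 < p) (hp2 : p < 2)
    (u : EuclideanSpace ℝ (Fin (n + 1)) → ℝ)
    (hu2 : ContDiffOn ℝ 2 u (halfSpace n))
    (huc : ContinuousOn u (closure (halfSpace n)))
    (heq : ∀ x ∈ halfSpace n, -laplacian u x = ‖gradient u x‖ ^ p)
    (hbc : ∀ x : EuclideanSpace ℝ (Fin (n + 1)), x (Fin.last n) = 0 → u x = 0) :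
    ∃ C : ℝ, ∀ x ∈ halfSpace n, |u x| ≤ C := by
  obtain ⟨C, hC0, hC⟩ := grad_bound n p hp1
  have hp0 : 0 < p - 1 := by linarith
  set a : ℝ := 1 / (p - 1) - 1 with ha
  have ha0 : 0 < a := by
    have : 1 < 1 / (p - 1) := by rw [lt_div_iff₀ hp0]; linarith
    linarith
  have hpa : (p - 1) * (a + 1) = 1 := by rw [ha]; field_simp; ring
  have hg : ∀ x ∈ halfSpace n, ‖gradient u x‖ ≤ C * (x (Fin.last n)) ^ (-(a + 1)) := by
    intro x hx
    have := hC u hu2 heq x hx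
    rwa [show a + 1 = 1 / (p - 1) by rw [ha]; ring]
  obtain ⟨L, hL⟩ := growth_bound ha0 hC0 hu2 hg
  have hCa : 0 < C / a := by positivity
  obtain ⟨M1, hM1⟩ := bounded_above hp1 ha0 hpa hCa hu2 huc (fun x hx => (heq x hx).le) hbc
    (fun x hx => (le_abs_self _).trans (hL x hx))
  obtain ⟨M2, hM2⟩ := bounded_above (g := -u) hp1 ha0 hpa hCa hu2.neg huc.neg
    (by
      intro x hx
      have h1 : laplacian (-u) x = -laplacian u x := by
        unfold laplacian
        simp [iteratedFDeriv_neg_apply]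
      rw [h1, heq x hx]
      have h2 : 0 ≤ ‖gradient u x‖ ^ p := by positivity
      have h3 : 0 ≤ ‖gradient (-u) x‖ ^ p := by positivity
      linarith)
    (fun x hx => by simp [hbc x hx])
    (fun x hx => (neg_le_abs _).trans (hL x hx))
  refine ⟨max M1 M2, fun x hx => abs_le.2 ⟨?_, (hM1 x hx).trans (le_max_left _ _)⟩⟩
  have h1 : -u x ≤ M2 := hM2 x hx
  have := le_max_right M1 M2
  linarith
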